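/- arXiv:1303.3494 — 2 statements merged into one kernel-verified Lean document; each statement's English description precedes it below -/
import Mathlib

section
/- Let R and S be commutative rings with S nontrivial, let M be an R-module and N an S-module, and let (φ,ψ) be an (R,S)-morphism from M to N. Then (ker φ, ker ψ) is an m-ideal of the R-module M. Furthermore, (ker φ, ker ψ) is a prime m-ideal if and only if ψ(M) is a nonzero torsion-free module over the subring φ(R) of S, i.e. ψ(M) ≠ {0} and for all r ∈ R and m ∈ M, φ(r)·ψ(m) = 0 implies φ(r) = 0 or ψ(m) = 0. -/
/-- `(I,N)` is an m-ideal of the `R`-module `M`: `I` is an ideal of `R`, `N` is a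
submodule of `M`, and `I·M ⊆ N`. -/
def IsMIdeal {R : Type} [CommRing R] {M : Type} [AddCommGroup M] [Module R M]
    (I : Ideal R) (N : Submodule R M) : Prop :=
  ∀ r ∈ I, ∀ m : M, r • m ∈ N

/-- The m-ideal `(I,N)` of the `R`-module `M` is prime: `I` is a (proper) prime ideal
of `R`, `N` is a proper submodule of `M`, and for every `r ∈ R`, `m ∈ M`, `r • m ∈ N`
implies `r ∈ I` or `m ∈ N`. -/
def IsPrimeMIdeal {R : Type} [CommRing R] {M : Type} [AddCommGroup M] [Module R M]
    (I : Ideal R) (N : Submodule R M) : Prop :=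
  IsMIdeal I N ∧ I.IsPrime ∧ N ≠ ⊤ ∧ ∀ (r : R) (m : M), r • m ∈ N → r ∈ I ∨ m ∈ N

/-- The kernel of the additive component `ψ` of an `(R,S)`-morphism `(φ,ψ)` from the
`R`-module `M` to the `S`-module `N`, as a submodule of `M` (it is closed under the
`R`-action since `ψ(r • m) = φ(r) • ψ(m)`). -/
def kerSubmodule {R S M N : Type} [CommRing R] [CommRing S]
    [AddCommGroup M] [Module R M] [AddCommGroup N] [Module S N]
    (φ : R →+* S) (ψ : M →+ N)
    (hcompat : ∀ (r : R) (m : M), ψ (r • m) = φ r • ψ m) : Submodule R M where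
  carrier := {m : M | ψ m = 0}
  add_mem' := by
    intro a b ha hb
    simp only [Set.mem_setOf_eq] at *
    simp [ha, hb]
  zero_mem' := by simp
  smul_mem' := by
    intro r m hm
    simp only [Set.mem_setOf_eq] at *
    simp [hcompat, hm]

theorem mem_kerSubmodule {R S M N : Type} [CommRing R] [CommRing S]
    [AddCommGroup M] [Module R M] [AddCommGroup N] [Module S N]
    (φ : R →+* S) (ψ : M →+ N)
    (hcompat : ∀ (r : R) (m : M), ψ (r • m) = φ r • ψ m) {m : M} :
    m ∈ kerSubmodule φ ψ hcompat ↔ ψ m = 0 :=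
  Iff.rfl

theorem isMIdeal_ker {R S M N : Type} [CommRing R] [CommRing S]
    [AddCommGroup M] [Module R M] [AddCommGroup N] [Module S N]
    (φ : R →+* S) (ψ : M →+ N)
    (hcompat : ∀ (r : R) (m : M), ψ (r • m) = φ r • ψ m) :
    IsMIdeal (RingHom.ker φ) (kerSubmodule φ ψ hcompat) := by
  intro r hr m
  rw [mem_kerSubmodule, hcompat, RingHom.mem_ker.mp hr, zero_smul]

/-- Lemma 5.5.
Let `R` and `S` be commutative rings with `S` nontrivial, let `M` be an `R`-module and
`N` an `S`-module, and let `(φ,ψ)` be an `(R,S)`-morphism from `M` to `N` (`φ` a ring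
homomorphism, `ψ` additive, `ψ(r•m) = φ(r)•ψ(m)`). Then `(ker φ, ker ψ)` is an
m-ideal of the `R`-module `M`. Furthermore, `(ker φ, ker ψ)` is a prime m-ideal if
and only if `ψ(M)` is a nonzero torsion-free module over the subring `φ(R)` of `S`,
i.e. `ψ(M) ≠ {0}` and for all `r ∈ R`, `m ∈ M`, `φ(r) • ψ(m) = 0` implies `φ(r) = 0`
or `ψ(m) = 0`. -/
theorem ker_mIdeal_and_prime_iff_torsionFree
    {R S M N : Type} [CommRing R] [CommRing S] [Nontrivial S]
    [AddCommGroup M] [Module R M] [AddCommGroup N] [Module S N]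
    (φ : R →+* S) (ψ : M →+ N)
    (hcompat : ∀ (r : R) (m : M), ψ (r • m) = φ r • ψ m) :
    IsMIdeal (RingHom.ker φ) (kerSubmodule φ ψ hcompat) ∧
      (IsPrimeMIdeal (RingHom.ker φ) (kerSubmodule φ ψ hcompat) ↔
        ((∃ m : M, ψ m ≠ 0) ∧
          ∀ (r : R) (m : M), φ r • ψ m = 0 → φ r = 0 ∨ ψ m = 0)) := by
  refine ⟨isMIdeal_ker φ ψ hcompat, ?_, ?_⟩
  · rintro ⟨-, -, hne, h⟩
    refine ⟨?_, fun r m hrm => ?_⟩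
    · by_contra! hzero
      exact hne (eq_top_iff.mpr fun m _ => hzero m)
    · exact h r m ((hcompat r m).trans hrm)
  · rintro ⟨⟨m, hm⟩, h⟩
    refine ⟨isMIdeal_ker φ ψ hcompat, ⟨RingHom.ker_ne_top φ, fun {a b} hab => ?_⟩, ?_,
      fun r x hrx => h r x ((hcompat r x).symm.trans hrx)⟩
    · have hab_smul : φ a • ψ (b • m) = 0 := by
        rw [hcompat, smul_smul, ← map_mul, RingHom.mem_ker.mp hab, zero_smul]
      refine (h a (b • m) hab_smul).imp_right fun hb => ?_
      exact (h b m ((hcompat b m).symm.trans hb)).resolve_right hm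
    · intro htop
      exact hm ((mem_kerSubmodule φ ψ hcompat).mp (htop ▸ Submodule.mem_top))
end

section
/- Let (I,N) be an m-ideal of the W(F)-module W(A,σ) such that N ≠ W(A,σ) and I = ker(π_p ∘ sign_P) for some P ∈ X_F and some prime p, where π_p : ℤ → ℤ/pℤ is the canonical projection. Then (I,N) is a prime m-ideal. -/
/-!
Abstract setting for signatures of hermitian forms over algebras with involution,
following V. Astier and T. Unger, "Signatures of hermitian forms and `prime ideals'
of Witt groups".

`OrderingData` encodes a formally real field `F` of characteristic `≠ 2` through:
its space of orderings `X = X_F` equipped with the Harrison topology (a compact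
space), its Witt ring `R = W(F)`, the signature ring homomorphisms
`sign P : W(F) →+* ℤ` for `P ∈ X_F`, the fundamental ideal `fund = I(F)`, together
with the classical facts about these data (Harrison's bijection between orderings
and ring homomorphisms `W(F) → ℤ`, continuity of total signatures, the
representation theorems Lam VIII.6.9/6.10, and the Harrison/Lorenz–Leicht
classification of prime ideals of `W(F)`).
-/
structure OrderingData where
  /-- the space of orderings `X_F` of the formally real field `F` -/
  X : Type
  [topX : TopologicalSpace X]
  [compactX : CompactSpace X]
  [nonemptyX : Nonempty X]
  /-- the Witt ring `W(F)` of quadratic forms over `F` -/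
  R : Type
  [ringR : CommRing R]
  /-- the signature of quadratic forms at the ordering `P` -/
  sign : X → R →+* ℤ
  sign_injective : Function.Injective sign
  /-- every ring homomorphism `W(F) → ℤ` is the signature at a (unique) ordering -/
  eq_sign_of_hom : ∀ f : R →+* ℤ, ∃ P, f = sign P
  /-- total signatures of quadratic forms are continuous -/
  sign_continuous : ∀ q : R, Continuous fun P => sign P q
  /-- Lam VIII.6.9/6.10: a `2`-power multiple of any continuous `ℤ`-valued map on `X_F`
  is a total signature -/
  exists_rep : ∀ f : X → ℤ, Continuous f → ∃ (n : ℕ) (q : R), ∀ P, sign P q = 2 ^ n * f P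
  /-- Harrison, Lorenz–Leicht: classification of the prime ideals of `W(F)` -/
  prime_classification : ∀ I : Ideal R, I.IsPrime →
    ∃ P, I = RingHom.ker (sign P) ∨
      ∃ p : ℕ, p.Prime ∧ I = RingHom.ker ((Int.castRingHom (ZMod p)).comp (sign P))
  /-- the fundamental ideal `I(F)` of `W(F)` -/
  fund : Ideal R
  fund_eq : ∀ P, fund = RingHom.ker ((Int.castRingHom (ZMod 2)).comp (sign P))

attribute [instance] OrderingData.topX OrderingData.compactX OrderingData.nonemptyX
  OrderingData.ringR

/-- The Witt group `W = W(A,σ)` of hermitian forms over an `F`-algebra with involution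
`(A,σ)` (a finite-dimensional `F`-algebra, simple or a product of two simple algebras,
with centre of dimension `≤ 2` over `F`, with an `F`-linear involution `σ`), as a
module over the Witt ring `R = W(F)`, together with, for each ordering `P ∈ X_F`, the
set `msign P` of M-signatures `sign_P^𝓜 : W(A,σ) → ℤ` (one for each Morita map `𝓜`
at `P`, i.e. each Witt group isomorphism induced by Morita equivalence between the
scalar extension of `(A,σ)` to a real closure `F_P` and the corresponding division
algebra with involution), and the basic facts about these from Astier–Unger:
M-signatures are `W(F)`-compatible additive maps, two M-signatures at the same
ordering agree up to a global sign, `Nil[A,σ]` is clopen, the torsion of `W(A,σ)` is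
`2`-primary (Scharlau) and Pfister's local–global principle holds. -/
structure HermWittData (Φ : OrderingData) where
  /-- the Witt group `W(A,σ)` -/
  W : Type
  [addW : AddCommGroup W]
  [modW : Module Φ.R W]
  /-- the M-signatures `sign_P^𝓜` at `P`, one for each Morita map `𝓜` at `P` -/
  msign : Φ.X → Set (W →+ ℤ)
  msign_nonempty : ∀ P, (msign P).Nonempty
  msign_smul : ∀ P, ∀ μ ∈ msign P, ∀ (q : Φ.R) (h : W), μ (q • h) = Φ.sign P q * μ h
  msign_pm : ∀ P, ∀ μ ∈ msign P, ∀ μ' ∈ msign P, μ' = μ ∨ μ' = -μ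
  nil_clopen : IsClopen {P | ∀ μ ∈ msign P, μ = (0 : W →+ ℤ)}
  torsion_two_primary : ∀ h : W, IsOfFinAddOrder h → ∃ n : ℕ, (2 ^ n : ℤ) • h = 0
  pfister : ∀ h : W, (∀ P, ∀ μ ∈ msign P, μ h = 0) → IsOfFinAddOrder h

attribute [instance] HermWittData.addW HermWittData.modW

namespace HermWittData

variable {Φ : OrderingData} (S : HermWittData Φ)

/-- the set `Nil[A,σ]` of nil orderings: those `P` where all M-signatures vanish
identically -/
def nil : Set Φ.X := {P | ∀ μ ∈ S.msign P, μ = (0 : S.W →+ ℤ)}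

/-- `H = (h_1, …, h_s)` is a tuple of reference forms: for every ordering
`P ∈ X_F \ Nil[A,σ]` and every Morita map `𝓜` at `P` there is an `i` with
`sign_P^𝓜 h_i ≠ 0`. -/
def IsRefTuple {s : ℕ} (H : Fin s → S.W) : Prop :=
  ∀ P ∉ S.nil, ∀ μ ∈ S.msign P, ∃ i, μ (H i) ≠ 0

/-- a choice of Morita map (i.e. of M-signature) at each ordering -/
noncomputable def msign₀ (P : Φ.X) : S.W →+ ℤ := (S.msign_nonempty P).choose

lemma msign₀_mem (P : Φ.X) : S.msign₀ P ∈ S.msign P := (S.msign_nonempty P).choose_spec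

open Classical in
/-- the normalising sign `δ ∈ {-1,1}`: the sign of `sign_P^𝓜 h_i` for the least index
`i` with `sign_P^𝓜 h_i ≠ 0` (and `0` if `P ∈ Nil[A,σ]`) -/
noncomputable def signCoef {s : ℕ} (H : Fin s → S.W) (P : Φ.X) : ℤ :=
  if P ∈ S.nil then 0
  else if hex : ∃ n, ∃ hn : n < s, S.msign₀ P (H ⟨n, hn⟩) ≠ 0 then
    if 0 < S.msign₀ P (H ⟨Nat.find hex, (Nat.find_spec hex).choose⟩) then 1 else -1
  else 0

/-- the `H`-signature `sign_P^H h` of `h ∈ W(A,σ)` at `P`: it is `0` if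
`P ∈ Nil[A,σ]`, and `δ · sign_P^𝓜 h` otherwise, where `δ` is the sign of
`sign_P^𝓜 h_i` for the least `i` with `sign_P^𝓜 h_i ≠ 0` -/
noncomputable def signH {s : ℕ} (H : Fin s → S.W) (P : Φ.X) (h : S.W) : ℤ :=
  S.signCoef H P * S.msign₀ P h

end HermWittData

/-- Lemma 6.3.
Let `(I,N)` be an m-ideal of the `W(F)`-module `W(A,σ)` with `N ≠ W(A,σ)` and
`I = ker (π_p ∘ sign_P)` for some ordering `P ∈ X_F` and some prime `p`, where
`π_p : ℤ → ℤ/pℤ` is the canonical projection. Then `(I,N)` is prime. -/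
theorem mIdeal_prime_of_ker_mod_p
    (Φ : OrderingData) (S : HermWittData Φ)
    (P : Φ.X) (p : ℕ) (hp : p.Prime)
    (I : Ideal Φ.R) (N : Submodule Φ.R S.W)
    (hI : I = RingHom.ker ((Int.castRingHom (ZMod p)).comp (Φ.sign P)))
    (hmi : IsMIdeal I N) (hN : N ≠ ⊤) :
    IsPrimeMIdeal I N := by
  have : Fact p.Prime := ⟨hp⟩
  refine ⟨hmi, hI ▸ RingHom.ker_isPrime _, hN, fun r m hrm => or_iff_not_imp_left.2 fun hr => ?_⟩
  have hne : ((Φ.sign P r : ℤ) : ZMod p) ≠ 0 := by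
    simpa [hI, RingHom.mem_ker] using hr
  -- An integer inverse of the signature of `r` modulo `p` gives an inverse of `r` modulo `I`.
  obtain ⟨k, hk⟩ := ZMod.intCast_surjective (((Φ.sign P r : ℤ) : ZMod p)⁻¹)
  have hmem : (k : Φ.R) * r - 1 ∈ I := by
    simp [hI, RingHom.mem_ker, hk, inv_mul_cancel₀ hne]
  have hdecomp : m = (k : Φ.R) • r • m - ((k : Φ.R) * r - 1) • m := by
    rw [sub_smul, mul_smul, one_smul, sub_sub_cancel]
  rw [hdecomp]
  exact N.sub_mem (N.smul_mem _ hrm) (hmi _ hmem m)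
end
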